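/- Fix τ > 0, M > 2ζ(1+τ), ρ > 0 and r > 0. For any A, h ∈ C^±_r such that A is invertible in the Banach algebra C^±_r, one has the factorization identity A·Δh − h·ΔA = ∇⁻( A·A⁺·∇(h/A) ), where Δ := ∇ − ∇⁻. -/

import Mathlib

open Complex Metric Set OnePoint

noncomputable section

/-- Real Riemann zeta value `ζ(s) = Σ_{m≥1} m^{-s}` for real `s`. -/
def zetaR (s : ℝ) : ℝ := ∑' n : ℕ, 1 / (n + 1 : ℝ) ^ s

/-- The set `A_M^ℝ` of real `(2+τ)`-Diophantine numbers with constant `M`. -/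
def AMR (τ M : ℝ) : Set ℝ :=
  {ω | ∀ n : ℤ, ∀ m : ℕ, 0 < m → 1 / (M * (m : ℝ) ^ (2 + τ)) ≤ |ω - n / m|}

/-- The complex extension `A_M^ℂ`. -/
def AMC (τ M : ℝ) : Set ℂ :=
  {ω | ∃ ω₀ ∈ AMR τ M, |ω₀ - ω.re| ≤ |ω.im|}

/-- `E(ω) = e^{2πiω}`. -/
def Efn (ω : ℂ) : ℂ := Complex.exp (2 * Real.pi * Complex.I * ω)

/-- The compact set `K_M = E(A_M^ℂ) ∪ {0,∞}` in the Riemann sphere `Ĉ = ℂ ∪ {∞}`. -/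
def KM (τ M : ℝ) : Set (OnePoint ℂ) :=
  (fun ω => ((Efn ω : ℂ) : OnePoint ℂ)) '' AMC τ M ∪ {((0 : ℂ) : OnePoint ℂ), ∞}

/-- The chart `ξ ↦ 1/ξ` of the Riemann sphere at `∞`. -/
def sphChart (ξ : ℂ) : OnePoint ℂ := if ξ = 0 then ∞ else ((ξ⁻¹ : ℂ) : OnePoint ℂ)

/-- `K ∩ ℂ`, in the coordinate `q`. -/
def finPart (K : Set (OnePoint ℂ)) : Set ℂ := {q : ℂ | (q : OnePoint ℂ) ∈ K}
/-- `K̃ = {ξ : 1/ξ ∈ K}`, the set `K` read in the coordinate `ξ = 1/q`. -/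
def infPart (K : Set (OnePoint ℂ)) : Set ℂ := {ξ : ℂ | sphChart ξ ∈ K}

variable {α : Type*} {B : Type*} [NormedAddCommGroup B] [NormedSpace ℂ B]

/-- Difference quotient error `Ω_{u,g}(q,q') = (u(q')−u(q))/(q'−q) − g(q)`,
for functions with values in a space of functions on `α`. -/
def omegaF (u g : ℂ → α → B) (p : ℂ × ℂ) (a : α) : B :=
  if p.1 = p.2 then 0 else (p.2 - p.1)⁻¹ • (u p.2 a - u p.1 a) - g p.1 a

/-- Continuity on `K` for the sup-norm over `S` of the values. -/
def ContSup (K : Set ℂ) (S : Set α) (u : ℂ → α → B) : Prop :=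
  ∀ q ∈ K, ∀ ε > (0 : ℝ), ∃ δ > (0 : ℝ), ∀ q' ∈ K, dist q' q < δ →
    ∀ a ∈ S, ‖u q' a - u q a‖ ≤ ε

/-- Continuity on `K × K` for the sup-norm over `S` of the values. -/
def ContSup2 (K : Set ℂ) (S : Set α) (F : ℂ × ℂ → α → B) : Prop :=
  ∀ p ∈ K ×ˢ K, ∀ ε > (0 : ℝ), ∃ δ > (0 : ℝ), ∀ p' ∈ K ×ˢ K, dist p' p < δ →
    ∀ a ∈ S, ‖F p' a - F p a‖ ≤ ε

/-- `u` is `C¹`-holomorphic on `K ⊂ ℂ` with derivative `g`, with values in the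
space of bounded functions on `S` (sup norm). -/
def FPair (K : Set ℂ) (S : Set α) (u g : ℂ → α → B) : Prop :=
  ContSup K S u ∧ ContSup K S g ∧ ContSup2 K S (omegaF u g)

def fn0 (K : Set ℂ) (S : Set α) (u : ℂ → α → B) : ℝ :=
  sSup {x : ℝ | ∃ q ∈ K, ∃ a ∈ S, x = ‖u q a‖}
def fdel (K : Set ℂ) (S : Set α) (u : ℂ → α → B) : ℝ :=
  sSup {x : ℝ | ∃ p ∈ K ×ˢ K, ∃ a ∈ S, x = ‖u (Prod.snd p) a - u (Prod.fst p) a‖}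
def fn2 (K : Set ℂ) (S : Set α) (u g : ℂ → α → B) : ℝ :=
  sSup {x : ℝ | ∃ p ∈ K ×ˢ K, ∃ a ∈ S, x = ‖omegaF u g p a‖}

/-- The `C¹_hol` norm `n₀ + max(sup‖φ'‖, sup‖δφ‖) + n₂` (one chart). -/
def fNorm (K : Set ℂ) (S : Set α) (u g : ℂ → α → B) : ℝ :=
  fn0 K S u + max (fn0 K S g) (fdel K S u) + fn2 K S u g

def FBdd (K : Set ℂ) (S : Set α) (u g : ℂ → α → B) : Prop :=
  BddAbove {x : ℝ | ∃ q ∈ K, ∃ a ∈ S, x = ‖u q a‖} ∧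
    BddAbove {x : ℝ | ∃ q ∈ K, ∃ a ∈ S, x = ‖g q a‖} ∧
    BddAbove {x : ℝ | ∃ p ∈ K ×ˢ K, ∃ a ∈ S, x = ‖omegaF u g p a‖}

/-- `C¹`-holomorphy on a subset `K` of the Riemann sphere: `C¹`-holomorphy in
both charts `q` and `ξ = 1/q`, with chartwise derivatives `g` and `h`. -/
def SPair (K : Set (OnePoint ℂ)) (S : Set α) (u : OnePoint ℂ → α → B)
    (g h : ℂ → α → B) : Prop :=
  FPair (finPart K) S (fun q : ℂ => u (q : OnePoint ℂ)) g ∧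
    FPair (infPart K) S (fun ξ : ℂ => u (sphChart ξ)) h

def SBdd (K : Set (OnePoint ℂ)) (S : Set α) (u : OnePoint ℂ → α → B)
    (g h : ℂ → α → B) : Prop :=
  FBdd (finPart K) S (fun q : ℂ => u (q : OnePoint ℂ)) g ∧
    FBdd (infPart K) S (fun ξ : ℂ => u (sphChart ξ)) h

/-- The `C¹_hol(K,·)` norm for `K ⊂ Ĉ`: max of the norms in the two charts. -/
def sNorm (K : Set (OnePoint ℂ)) (S : Set α) (u : OnePoint ℂ → α → B)
    (g h : ℂ → α → B) : ℝ :=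
  max (fNorm (finPart K) S (fun q : ℂ => u (q : OnePoint ℂ)) g)
    (fNorm (infPart K) S (fun ξ : ℂ => u (sphChart ξ)) h)

/-- The strip `S_r` (identified with `{x ∈ ℂ/ℤ : |Im x| < r}` via 1-periodicity). -/
def Strip (r : ℝ) : Set ℂ := {z : ℂ | |z.im| < r}

/-- `S_r × D_ρ`, the domain of the elements of `B_{r,ρ} = H^∞(S_r × D_ρ)`. -/
def SD (r ρ : ℝ) : Set (ℂ × ℂ) := Strip r ×ˢ Metric.ball (0 : ℂ) ρ

/-- Membership of a value in `B_{r,ρ} = H^∞(S_r × D_ρ) = H^∞(S_r, B_ρ)`: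
1-periodicity in `θ` and holomorphy on `S_r × D_ρ` (boundedness being part of
the `C¹_hol` data). -/
def ValHol (r ρ : ℝ) (v : ℂ × ℂ → ℂ) : Prop :=
  (∀ θ ε : ℂ, v (θ + 1, ε) = v (θ, ε)) ∧ DifferentiableOn ℂ v (SD r ρ)

/-- `u ∈ C_r = C¹_hol(K_M, H^∞(S_r, B_ρ))`, with chartwise derivative data `g, h`. -/
def MemC (τ M r ρ : ℝ) (u : OnePoint ℂ → ℂ × ℂ → ℂ) (g h : ℂ → ℂ × ℂ → ℂ) : Prop :=
  SPair (KM τ M) (SD r ρ) u g h ∧ SBdd (KM τ M) (SD r ρ) u g h ∧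
    ∀ q ∈ KM τ M, ValHol r ρ (u q)

/-- The norm `‖u‖_r` of `u ∈ C_r`, given its derivative data `g, h`. -/
def CNorm (τ M r ρ : ℝ) (u : OnePoint ℂ → ℂ × ℂ → ℂ) (g h : ℂ → ℂ × ℂ → ℂ) : ℝ :=
  sNorm (KM τ M) (SD r ρ) u g h

/-- The `k`-th Fourier coefficient `φ̂_k(q) ∈ B_ρ` of `u(q) ∈ H^∞(S_r, B_ρ)`. -/
def fhat (u : OnePoint ℂ → ℂ × ℂ → ℂ) (k : ℤ) (q : OnePoint ℂ) (ε : ℂ) : ℂ :=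
  ∫ t in (0:ℝ)..1, u q ((t : ℂ), ε) * Complex.exp (-(2 * Real.pi * Complex.I * k * t))

/-- `e_k(θ) = e^{2πikθ}`. -/
def ek (k : ℤ) (θ : ℂ) : ℂ := Complex.exp (2 * Real.pi * Complex.I * k * θ)

/-- `up = u⁺`, i.e. `up(q,θ) = Σ_k q^k û_k(q) e_k(θ)` on `K_M` (for `q = e^{2πiω}`
this is `u(q, θ+ω)`). -/
def IsPlus (τ M r ρ : ℝ) (u up : OnePoint ℂ → ℂ × ℂ → ℂ) : Prop :=
  ∀ q : ℂ, (q : OnePoint ℂ) ∈ KM τ M → q ≠ 0 → ∀ θ ∈ Strip r,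
    ∀ ε ∈ Metric.ball (0 : ℂ) ρ,
      HasSum (fun k : ℤ => q ^ k * fhat u k (q : OnePoint ℂ) ε * ek k θ)
        (up (q : OnePoint ℂ) (θ, ε))

/-- `um = u⁻`, i.e. `um(q,θ) = Σ_k q^{-k} û_k(q) e_k(θ)`. -/
def IsMinus (τ M r ρ : ℝ) (u um : OnePoint ℂ → ℂ × ℂ → ℂ) : Prop :=
  ∀ q : ℂ, (q : OnePoint ℂ) ∈ KM τ M → q ≠ 0 → ∀ θ ∈ Strip r,
    ∀ ε ∈ Metric.ball (0 : ℂ) ρ,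
      HasSum (fun k : ℤ => q ^ (-k) * fhat u k (q : OnePoint ℂ) ε * ek k θ)
        (um (q : OnePoint ℂ) (θ, ε))

/-- The derivative `∂_θ` acting on values. -/
def dth (v : OnePoint ℂ → ℂ × ℂ → ℂ) (q : OnePoint ℂ) (p : ℂ × ℂ) : ℂ :=
  deriv (fun t => v q (t, p.2)) p.1

/-- Real-symmetry (`u ∈ C_{r,ℝ}`): `conj(û_k(q)) = û_{-k}(1/q̄)` where
`(conj ψ)(ε) = conj(ψ(ε̄))` in `B_ρ`. -/
def RealSym (τ M : ℝ) (u : OnePoint ℂ → ℂ × ℂ → ℂ) : Prop :=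
  ∀ k : ℤ, ∀ q : ℂ, (q : OnePoint ℂ) ∈ KM τ M → q ≠ 0 → ∀ ε : ℂ,
    starRingEnd ℂ (fhat u k (q : OnePoint ℂ) (starRingEnd ℂ ε)) =
      fhat u (-k) (((((starRingEnd ℂ) q)⁻¹ : ℂ) : OnePoint ℂ)) ε

/-- `f ∈ C_r` (existence of `C¹`-holomorphic derivative data). -/
def InC (τ M r ρ : ℝ) (f : OnePoint ℂ → ℂ × ℂ → ℂ) : Prop :=
  ∃ g h : ℂ → ℂ × ℂ → ℂ, MemC τ M r ρ f g h


theorem ek_add (j k : ℤ) (θ : ℂ) : ek (j + k) θ = ek j θ * ek k θ := by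
  simp only [ek, ← Complex.exp_add]
  congr 1
  push_cast
  ring

theorem ek_zero_right (k : ℤ) : ek k 0 = 1 := by simp [ek]

theorem norm_ek_ofReal (k : ℤ) (t : ℝ) : ‖ek k t‖ = 1 := by
  have : (2 * Real.pi * Complex.I * k * t : ℂ) = ((2 * Real.pi * k * t : ℝ) : ℂ) * Complex.I := by
    push_cast
    ring
  rw [ek, this, Complex.norm_exp_ofReal_mul_I]

theorem continuous_ek_ofReal (k : ℤ) : Continuous fun t : ℝ => ek k t := by
  unfold ek
  fun_prop

theorem integral_ek (k : ℤ) : ∫ t in (0:ℝ)..1, ek k t = if k = 0 then 1 else 0 := by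
  split_ifs with hk
  · simp [hk, ek]
  · have hc : (2 * Real.pi * Complex.I * k : ℂ) ≠ 0 := by
      simp [hk, Real.pi_ne_zero]
    have h := integral_exp_mul_complex (a := 0) (b := 1) hc
    simp only [ek]
    rw [h]
    have : Complex.exp (2 * Real.pi * Complex.I * k) = 1 :=
      Complex.exp_eq_one_iff.2 ⟨k, by ring⟩
    simp [this]

/-- `u` is the sum of the trigonometric series with coefficients `c` on the real line. -/
def HasFourier (u : ℝ → ℂ) (c : ℤ → ℂ) : Prop :=
  ∀ t : ℝ, HasSum (fun k : ℤ => c k * ek k t) (u t)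

theorem HasFourier.summable_norm {u : ℝ → ℂ} {c : ℤ → ℂ} (h : HasFourier u c) :
    Summable fun k => ‖c k‖ := by
  simpa [ek_zero_right] using (h 0).summable.norm

theorem HasFourier.integral_eq {u : ℝ → ℂ} {c : ℤ → ℂ} (h : HasFourier u c) (k : ℤ) :
    ∫ t in (0:ℝ)..1, u t * Complex.exp (-(2 * Real.pi * Complex.I * k * t)) = c k := by
  have hexp : ∀ t : ℝ, Complex.exp (-(2 * Real.pi * Complex.I * k * t)) = ek (-k) t := by
    intro t
    simp only [ek]
    congr 1
    push_cast
    ring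
  simp only [hexp]
  have hsum : HasSum (fun j : ℤ => ∫ t in (0:ℝ)..1, c j * ek (j - k) t)
      (∫ t in (0:ℝ)..1, u t * ek (-k) t) := by
    refine intervalIntegral.hasSum_integral_of_dominated_convergence (fun j _ => ‖c j‖)
      (fun j => ?_) (fun j => ?_) ?_ ?_ ?_
    · exact ((continuous_ek_ofReal (j - k)).const_mul (c j)).aestronglyMeasurable
    · filter_upwards with t _
      simp [norm_ek_ofReal]
    · filter_upwards with t _
      exact h.summable_norm
    · simp
    · filter_upwards with t _
      have := (h t).mul_right (ek (-k) t)
      simpa [mul_assoc, ← ek_add, sub_eq_add_neg] using this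
  have hval : (fun j : ℤ => ∫ t in (0:ℝ)..1, c j * ek (j - k) t)
      = fun j => if j = k then c k else 0 := by
    funext j
    rw [intervalIntegral.integral_const_mul, integral_ek]
    by_cases hj : j = k
    · simp [hj]
    · simp [hj, sub_eq_zero]
  rw [hval] at hsum
  exact hsum.unique (hasSum_ite_eq k (c k))

theorem HasFourier.sub {u v : ℝ → ℂ} {a b : ℤ → ℂ} (hu : HasFourier u a) (hv : HasFourier v b) :
    HasFourier (fun t => u t - v t) fun k => a k - b k := fun t => by
  simpa [sub_mul] using (hu t).sub (hv t)

theorem HasFourier.mul {u v : ℝ → ℂ} {a b : ℤ → ℂ} (hu : HasFourier u a) (hv : HasFourier v b) :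
    HasFourier (fun t => u t * v t) fun k => ∑' j, a j * b (k - j) := by
  let e : ℤ × ℤ ≃ ℤ × ℤ :=
    { toFun := fun p => (p.2, p.1 - p.2)
      invFun := fun p => (p.1 + p.2, p.1)
      left_inv := fun p => by simp
      right_inv := fun p => by simp }
  have key : ∀ t : ℝ, HasSum (fun p : ℤ × ℤ => a p.2 * b (p.1 - p.2) * ek p.1 t) (u t * v t) := by
    intro t
    have hs : Summable fun p : ℤ × ℤ => (a p.1 * ek p.1 t) * (b p.2 * ek p.2 t) :=
      summable_mul_of_summable_norm (f := fun k : ℤ => a k * ek k t) (g := fun k : ℤ => b k * ek k t)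
        (hu t).summable.norm (hv t).summable.norm
    have h := e.hasSum_iff.2 ((hu t).mul (hv t) hs)
    refine h.congr_fun ?_
    rintro ⟨k, j⟩
    have : ek k (t : ℂ) = ek j t * ek (k - j) t := by rw [← ek_add]; congr 1; ring
    simp only [e, Function.comp, Equiv.coe_fn_mk, this]
    ring
  intro t
  refine (key t).prod_fiberwise fun k => ?_
  have h0 := (key 0).summable.prod_factor k
  simp only [Complex.ofReal_zero, ek_zero_right, mul_one] at h0
  exact h0.hasSum.mul_right _

/-- `u'` is obtained from `u` by multiplying the `k`-th Fourier coefficient by `s ^ k`. -/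
def IsTwist (s : ℂ) (u u' : ℝ → ℂ) : Prop :=
  ∃ c : ℤ → ℂ, HasFourier u c ∧ HasFourier u' fun k => s ^ k * c k

theorem IsTwist.symm {s : ℂ} (hs : s ≠ 0) {u u' : ℝ → ℂ} (h : IsTwist s u u') :
    IsTwist s⁻¹ u' u := by
  obtain ⟨c, h1, h2⟩ := h
  refine ⟨_, h2, ?_⟩
  convert h1 using 2 with k
  rw [inv_zpow, inv_mul_cancel_left₀ (zpow_ne_zero k hs)]

theorem IsTwist.sub {s : ℂ} {u u' v v' : ℝ → ℂ} (hu : IsTwist s u u') (hv : IsTwist s v v') :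
    IsTwist s (fun t => u t - v t) fun t => u' t - v' t := by
  obtain ⟨a, h1, h2⟩ := hu
  obtain ⟨b, h3, h4⟩ := hv
  refine ⟨_, h1.sub h3, ?_⟩
  simpa only [mul_sub] using h2.sub h4

theorem IsTwist.mul {s : ℂ} (hs : s ≠ 0) {u u' v v' : ℝ → ℂ} (hu : IsTwist s u u')
    (hv : IsTwist s v v') : IsTwist s (fun t => u t * v t) fun t => u' t * v' t := by
  obtain ⟨a, h1, h2⟩ := hu
  obtain ⟨b, h3, h4⟩ := hv
  refine ⟨_, h1.mul h3, ?_⟩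
  convert h2.mul h4 using 2 with k
  rw [← tsum_mul_left]
  refine tsum_congr fun j => ?_
  have : s ^ k = s ^ j * s ^ (k - j) := by rw [← zpow_add₀ hs]; congr 1; ring
  rw [this]
  ring

theorem IsTwist.hasSum {s : ℂ} {u u' : ℝ → ℂ} (h : IsTwist s u u') (t : ℝ) :
    HasSum (fun k : ℤ => s ^ k *
      (∫ x in (0:ℝ)..1, u x * Complex.exp (-(2 * Real.pi * Complex.I * k * x))) * ek k t)
      (u' t) := by
  obtain ⟨c, h1, h2⟩ := h
  simpa only [h1.integral_eq] using h2 t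

theorem IsTwist.unique {s : ℂ} {u u' u'' : ℝ → ℂ} (h : IsTwist s u u') (h' : IsTwist s u u'') :
    u' = u'' :=
  funext fun t => (h.hasSum t).unique (h'.hasSum t)

/-- A continuous `1`-periodic function with summable Fourier coefficients is the sum of its
Fourier series. -/
theorem hasFourier_of_summable {u : ℝ → ℂ} (hc : Continuous u) (hp : Function.Periodic u 1)
    (hs : Summable fun k : ℤ =>
      ∫ x in (0:ℝ)..1, u x * Complex.exp (-(2 * Real.pi * Complex.I * k * x))) :
    HasFourier u fun k : ℤ =>
      ∫ x in (0:ℝ)..1, u x * Complex.exp (-(2 * Real.pi * Complex.I * k * x)) := by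
  have : Fact ((0:ℝ) < 1) := ⟨one_pos⟩
  let f : C(AddCircle (1:ℝ), ℂ) := ⟨hp.lift, continuous_coinduced_dom.2 hc⟩
  have hf : ∀ k : ℤ, fourierCoeff f k =
      ∫ x in (0:ℝ)..1, u x * Complex.exp (-(2 * Real.pi * Complex.I * k * x)) := by
    intro k
    rw [fourierCoeff_eq_intervalIntegral _ _ 0]
    simp only [zero_add, div_one, one_smul]
    refine intervalIntegral.integral_congr fun x _ => ?_
    simp only [fourier_coe_apply, smul_eq_mul]
    rw [mul_comm]
    congr 1
    congr 1
    push_cast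
    ring
  intro t
  have h := has_pointwise_sum_fourier_series_of_summable (f := f) (by rwa [funext hf]) t
  simp only [hf, fourier_coe_apply, smul_eq_mul, Complex.ofReal_one, div_one] at h
  exact h

theorem summable_one_div_add_one_rpow {τ : ℝ} (hτ : 0 < τ) :
    Summable fun n : ℕ => 1 / (n + 1 : ℝ) ^ (1 + τ) := by
  have h := (summable_nat_add_iff 1).2 (Real.summable_one_div_nat_rpow.2 (by linarith : 1 < 1 + τ))
  simpa using h

theorem one_le_zetaR {τ : ℝ} (hτ : 0 < τ) : 1 ≤ zetaR (1 + τ) := by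
  have h := (summable_one_div_add_one_rpow hτ).le_tsum 0 fun n _ => by positivity
  simpa [zetaR] using h

theorem exists_int_approx_of_notMem_AMR {τ M x : ℝ} (hτ : 0 < τ) (hM : 0 < M)
    (hx : x ∈ Icc (1 / M) (1 - 1 / M)) (hn : x ∉ AMR τ M) :
    ∃ k j : ℕ, j < k ∧ |x - (j + 1 : ℝ) / (k + 1)| < 1 / (M * (k + 1 : ℝ) ^ (2 + τ)) := by
  simp only [AMR, mem_ofPred_eq, not_forall, not_le] at hn
  obtain ⟨n, m, hm, hlt⟩ := hn
  have hm1 : (1 : ℝ) ≤ m := by exact_mod_cast hm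
  have hm0 : (0 : ℝ) < m := by linarith
  have hr : 1 / (M * (m : ℝ) ^ (2 + τ)) ≤ 1 / M := by
    apply one_div_le_one_div_of_le hM
    have := Real.one_le_rpow hm1 (by linarith : 0 ≤ 2 + τ)
    nlinarith
  have habs := abs_lt.1 (hlt.trans_le hr)
  have hn0 : 0 < n := by
    by_contra! h
    have h1 : (n : ℝ) / m ≤ 0 := div_nonpos_of_nonpos_of_nonneg (by exact_mod_cast h) hm0.le
    linarith [hx.1]
  have hnm : n < m := by
    by_contra! h
    have h1 : 1 ≤ (n : ℝ) / m := by
      rw [one_le_div hm0]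
      exact_mod_cast h
    linarith [hx.2]
  refine ⟨m - 1, (n - 1).toNat, by omega, ?_⟩
  have h1 : ((m - 1 : ℕ) : ℝ) + 1 = m := by
    rw [Nat.cast_sub hm]
    simp
  have h2 : (((n - 1).toNat : ℕ) : ℝ) + 1 = n := by
    have : (((n - 1).toNat : ℕ) : ℤ) = n - 1 := Int.toNat_of_nonneg (by omega)
    have h3 : (((n - 1).toNat : ℕ) : ℝ) = ((n - 1 : ℤ) : ℝ) := by exact_mod_cast this
    rw [h3]
    push_cast
    ring
  rw [h1, h2]
  exact hlt

theorem AMR_nonempty {τ M : ℝ} (hτ : 0 < τ) (hM : 2 * zetaR (1 + τ) < M) :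
    (AMR τ M).Nonempty := by
  have hM2 : 2 < M := by linarith [one_le_zetaR hτ]
  have hM0 : 0 < M := by linarith
  by_contra hemp
  rw [not_nonempty_iff_eq_empty] at hemp
  have hcover : Icc (1 / M) (1 - 1 / M) ⊆ ⋃ k : ℕ, ⋃ j ∈ Finset.range k,
      ball ((j + 1 : ℝ) / (k + 1)) (1 / (M * (k + 1 : ℝ) ^ (2 + τ))) := by
    intro x hx
    obtain ⟨k, j, hjk, h⟩ := exists_int_approx_of_notMem_AMR hτ hM0 hx (by simp [hemp])
    simp only [mem_iUnion]
    exact ⟨k, j, Finset.mem_range.2 hjk, by rwa [mem_ball, Real.dist_eq]⟩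
  let g : ℕ → ℝ := fun k => 2 / M * (1 / (k + 1 : ℝ) ^ (1 + τ) - if k = 0 then 1 else 0)
  have hg : HasSum g (2 / M * (zetaR (1 + τ) - 1)) :=
    ((summable_one_div_add_one_rpow hτ).hasSum.sub (hasSum_ite_eq 0 1)).mul_left _
  have hle : ∀ k : ℕ, k * (2 * (1 / (M * (k + 1 : ℝ) ^ (2 + τ)))) ≤ g k := by
    intro k
    rcases Nat.eq_zero_or_pos k with rfl | hk
    · simp [g]
    · have hk0 : (0 : ℝ) < k + 1 := by positivity
      have hp : (0 : ℝ) < (k + 1 : ℝ) ^ (1 + τ) := by positivity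
      have : (k + 1 : ℝ) ^ (2 + τ) = (k + 1) * (k + 1 : ℝ) ^ (1 + τ) := by
        rw [show 2 + τ = 1 + (1 + τ) by ring, Real.rpow_add hk0, Real.rpow_one]
      simp only [g, hk.ne', if_false, sub_zero, this]
      have e : (k : ℝ) * (2 * (1 / (M * ((k + 1) * (k + 1 : ℝ) ^ (1 + τ)))))
          = 2 / M * (1 / (k + 1 : ℝ) ^ (1 + τ)) * (k / (k + 1)) := by
        field_simp
      rw [e]
      refine mul_le_of_le_one_right (by positivity) ?_
      rw [div_le_one hk0]
      linarith
  have hg0 : ∀ k, 0 ≤ g k := fun k => le_trans (by positivity) (hle k)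
  have hvol : ENNReal.ofReal (1 - 1 / M - 1 / M) ≤
      ENNReal.ofReal (2 / M * (zetaR (1 + τ) - 1)) := by
    calc ENNReal.ofReal (1 - 1 / M - 1 / M)
        = MeasureTheory.volume (Icc (1 / M) (1 - 1 / M)) := Real.volume_Icc.symm
      _ ≤ _ := MeasureTheory.measure_mono hcover
      _ ≤ ∑' k : ℕ, MeasureTheory.volume (⋃ j ∈ Finset.range k,
            ball ((j + 1 : ℝ) / (k + 1)) (1 / (M * (k + 1 : ℝ) ^ (2 + τ)))) :=
          MeasureTheory.measure_iUnion_le _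
      _ ≤ ∑' k : ℕ, ENNReal.ofReal (g k) := by
          refine ENNReal.tsum_le_tsum fun k => ?_
          refine (MeasureTheory.measure_biUnion_finset_le _ _).trans ?_
          simp only [Real.volume_ball, Finset.sum_const, Finset.card_range, nsmul_eq_mul]
          rw [← ENNReal.ofReal_natCast, ← ENNReal.ofReal_mul (by positivity)]
          exact ENNReal.ofReal_le_ofReal (hle k)
      _ = ENNReal.ofReal (2 / M * (zetaR (1 + τ) - 1)) := by
          rw [← ENNReal.ofReal_tsum_of_nonneg hg0 hg.summable, hg.tsum_eq]
  have hpos : 0 ≤ 2 / M * (zetaR (1 + τ) - 1) :=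
    mul_nonneg (by positivity) (by linarith [one_le_zetaR hτ])
  rw [ENNReal.ofReal_le_ofReal_iff hpos] at hvol
  have h1 : 1 ≤ 2 * zetaR (1 + τ) / M := by
    have : 2 / M * (zetaR (1 + τ) - 1) = 2 * zetaR (1 + τ) / M - 1 / M - 1 / M := by ring
    linarith
  rw [one_le_div hM0] at h1
  linarith

theorem norm_Efn (ω : ℂ) : ‖Efn ω‖ = Real.exp (-(2 * Real.pi * ω.im)) := by
  rw [Efn, Complex.norm_exp]
  simp

theorem Efn_ne_zero (ω : ℂ) : Efn ω ≠ 0 := Complex.exp_ne_zero _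

theorem mem_AMC_of_mem_AMR {τ M ω₀ : ℝ} (h : ω₀ ∈ AMR τ M) (y : ℝ) :
    (⟨ω₀, y⟩ : ℂ) ∈ AMC τ M := ⟨ω₀, h, by simp⟩

theorem Efn_mem_KM {τ M : ℝ} {ω : ℂ} (h : ω ∈ AMC τ M) : (Efn ω : OnePoint ℂ) ∈ KM τ M :=
  Or.inl ⟨ω, h, rfl⟩

theorem exists_exp_neg_two_pi_mul_lt {ε : ℝ} (hε : 0 < ε) :
    ∃ y : ℝ, Real.exp (-(2 * Real.pi * y)) < ε := by
  refine ⟨(1 - Real.log ε) / (2 * Real.pi), ?_⟩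
  rw [mul_div_cancel₀ _ (by positivity), ← Real.lt_log_iff_exp_lt hε]
  linarith

theorem finPart_KM_subset_closure {τ M : ℝ} (hne : (AMR τ M).Nonempty) :
    finPart (KM τ M) ⊆ closure (finPart (KM τ M) \ {0}) := by
  intro q hq
  rcases eq_or_ne q 0 with rfl | hq0
  · obtain ⟨ω₀, hω⟩ := hne
    refine Metric.mem_closure_iff.2 fun ε hε => ?_
    obtain ⟨y, hy⟩ := exists_exp_neg_two_pi_mul_lt hε
    refine ⟨Efn ⟨ω₀, y⟩, ⟨Efn_mem_KM (mem_AMC_of_mem_AMR hω y), Efn_ne_zero _⟩, ?_⟩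
    rwa [dist_zero_left, norm_Efn]
  · exact subset_closure ⟨hq, hq0⟩

theorem sphChart_of_ne_zero {ξ : ℂ} (h : ξ ≠ 0) : sphChart ξ = ((ξ⁻¹ : ℂ) : OnePoint ℂ) :=
  if_neg h

theorem infPart_KM_subset_closure {τ M : ℝ} (hne : (AMR τ M).Nonempty) :
    infPart (KM τ M) ⊆ closure (infPart (KM τ M) \ {0}) := by
  intro q hq
  rcases eq_or_ne q 0 with rfl | hq0
  · obtain ⟨ω₀, hω⟩ := hne
    refine Metric.mem_closure_iff.2 fun ε hε => ?_
    obtain ⟨y, hy⟩ := exists_exp_neg_two_pi_mul_lt hε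
    have hE : (Efn ⟨ω₀, -y⟩)⁻¹ ≠ 0 := inv_ne_zero (Efn_ne_zero _)
    refine ⟨(Efn ⟨ω₀, -y⟩)⁻¹, ⟨?_, hE⟩, ?_⟩
    · simp only [infPart, mem_ofPred_eq, sphChart_of_ne_zero hE, inv_inv]
      exact Efn_mem_KM (mem_AMC_of_mem_AMR hω (-y))
    · rw [dist_zero_left, norm_inv, norm_Efn, ← Real.exp_neg]
      simpa using hy
  · exact subset_closure ⟨hq, hq0⟩

theorem ContSup.continuousOn {β E : Type*} [NormedAddCommGroup E] {K : Set ℂ} {S : Set β}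
    {u : ℂ → β → E} (h : ContSup K S u) {a : β} (ha : a ∈ S) : ContinuousOn (fun q => u q a) K := by
  intro q hq
  refine Metric.continuousWithinAt_iff.2 fun ε hε => ?_
  obtain ⟨δ, hδ, H⟩ := h q hq (ε / 2) (half_pos hε)
  refine ⟨δ, hδ, fun q' hq' hd => ?_⟩
  rw [dist_eq_norm]
  linarith [H q' hq' hd a ha]

section InC

variable {τ M r ρ : ℝ} {u : OnePoint ℂ → ℂ × ℂ → ℂ}

theorem InC.continuousOn_finPart (h : InC τ M r ρ u) {pt : ℂ × ℂ} (hpt : pt ∈ SD r ρ) :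
    ContinuousOn (fun q : ℂ => u (q : OnePoint ℂ) pt) (finPart (KM τ M)) := by
  obtain ⟨g, k, ⟨⟨hc, -⟩, -⟩, -⟩ := h
  exact hc.continuousOn hpt

theorem InC.continuousOn_infPart (h : InC τ M r ρ u) {pt : ℂ × ℂ} (hpt : pt ∈ SD r ρ) :
    ContinuousOn (fun ξ : ℂ => u (sphChart ξ) pt) (infPart (KM τ M)) := by
  obtain ⟨g, k, ⟨-, ⟨hc, -⟩⟩, -⟩ := h
  exact hc.continuousOn hpt

theorem InC.valHol (h : InC τ M r ρ u) {q : OnePoint ℂ} (hq : q ∈ KM τ M) :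
    ValHol r ρ (u q) := by
  obtain ⟨g, k, -, -, hv⟩ := h
  exact hv q hq

theorem InC.differentiableOn (h : InC τ M r ρ u) {q : OnePoint ℂ} (hq : q ∈ KM τ M) {ε : ℂ}
    (hε : ε ∈ ball (0 : ℂ) ρ) : DifferentiableOn ℂ (fun θ => u q (θ, ε)) (Strip r) :=
  (h.valHol hq).2.comp (by fun_prop) fun _ hθ => ⟨hθ, hε⟩

theorem ofReal_mem_Strip (hr : 0 < r) (t : ℝ) : (t : ℂ) ∈ Strip r := by
  simpa [Strip] using hr

theorem InC.continuous_ofReal (h : InC τ M r ρ u) (hr : 0 < r) {q : OnePoint ℂ}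
    (hq : q ∈ KM τ M) {ε : ℂ} (hε : ε ∈ ball (0 : ℂ) ρ) :
    Continuous fun t : ℝ => u q (t, ε) :=
  (h.differentiableOn hq hε).continuousOn.comp_continuous Complex.continuous_ofReal
    (ofReal_mem_Strip hr)

theorem summable_of_zpow_mul {q : ℂ} (hq : q ≠ 0) {c : ℤ → ℂ}
    (h1 : Summable fun k : ℤ => q ^ k * c k) (h2 : Summable fun k : ℤ => q ^ (-k) * c k) :
    Summable c := by
  refine Summable.of_norm_bounded (h1.norm.add h2.norm) fun k => ?_
  have hx : 0 < ‖q ^ k‖ := norm_pos_iff.2 (zpow_ne_zero k hq)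
  rw [norm_mul, norm_mul, zpow_neg, norm_inv, ← add_mul]
  refine le_mul_of_one_le_left (norm_nonneg _) ?_
  rcases le_total 1 ‖q ^ k‖ with h | h
  · have := inv_pos.2 hx
    linarith
  · have := (one_le_inv₀ hx).2 h
    linarith

theorem InC.hasFourier (h : InC τ M r ρ u) {up um : OnePoint ℂ → ℂ × ℂ → ℂ}
    (hp : IsPlus τ M r ρ u up) (hm : IsMinus τ M r ρ u um) (hr : 0 < r) {q : ℂ} (hq0 : q ≠ 0)
    (hq : (q : OnePoint ℂ) ∈ KM τ M) {ε : ℂ} (hε : ε ∈ ball (0 : ℂ) ρ) :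
    HasFourier (fun t => u q (t, ε)) fun k => fhat u k q ε := by
  refine hasFourier_of_summable (h.continuous_ofReal hr hq hε) (fun t => ?_) ?_
  · simpa using (h.valHol hq).1 t ε
  · refine summable_of_zpow_mul hq0 ?_ ?_
    · simpa [ek_zero_right, fhat] using (hp q hq hq0 _ (ofReal_mem_Strip hr 0) ε hε).summable
    · simpa [ek_zero_right, fhat] using (hm q hq hq0 _ (ofReal_mem_Strip hr 0) ε hε).summable

theorem InC.isTwist_plus (h : InC τ M r ρ u) {up um : OnePoint ℂ → ℂ × ℂ → ℂ}
    (hp : IsPlus τ M r ρ u up) (hm : IsMinus τ M r ρ u um) (hr : 0 < r) {q : ℂ} (hq0 : q ≠ 0)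
    (hq : (q : OnePoint ℂ) ∈ KM τ M) {ε : ℂ} (hε : ε ∈ ball (0 : ℂ) ρ) :
    IsTwist q (fun t => u q (t, ε)) fun t => up q (t, ε) :=
  ⟨_, h.hasFourier hp hm hr hq0 hq hε, fun t => hp q hq hq0 t (ofReal_mem_Strip hr t) ε hε⟩

theorem InC.isTwist_minus (h : InC τ M r ρ u) {up um : OnePoint ℂ → ℂ × ℂ → ℂ}
    (hp : IsPlus τ M r ρ u up) (hm : IsMinus τ M r ρ u um) (hr : 0 < r) {q : ℂ} (hq0 : q ≠ 0)
    (hq : (q : OnePoint ℂ) ∈ KM τ M) {ε : ℂ} (hε : ε ∈ ball (0 : ℂ) ρ) :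
    IsTwist q⁻¹ (fun t => u q (t, ε)) fun t => um q (t, ε) := by
  refine ⟨_, h.hasFourier hp hm hr hq0 hq hε, fun t => ?_⟩
  simpa only [inv_zpow'] using hm q hq hq0 t (ofReal_mem_Strip hr t) ε hε

end InC

theorem isOpen_Strip (r : ℝ) : IsOpen (Strip r) :=
  isOpen_lt (by fun_prop) continuous_const

theorem isPreconnected_Strip (r : ℝ) : IsPreconnected (Strip r) := by
  have : Strip r = Complex.imLm ⁻¹' Ioo (-r) r := by
    ext z
    simp [Strip, abs_lt]
  rw [this]
  exact ((convex_Ioo (-r) r).linear_preimage _).isPreconnected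

/-- A holomorphic function on a strip vanishing on the real line is zero. -/
theorem eqOn_zero_Strip {r : ℝ} (hr : 0 < r) {f : ℂ → ℂ} (hf : DifferentiableOn ℂ f (Strip r))
    (h0 : ∀ t : ℝ, f t = 0) : EqOn f 0 (Strip r) := by
  refine (hf.analyticOnNhd (isOpen_Strip r)).eqOn_zero_of_preconnected_of_frequently_eq_zero
    (isPreconnected_Strip r) (by simpa using ofReal_mem_Strip hr 0 : (0 : ℂ) ∈ Strip r) ?_
  have ht : Filter.Tendsto (fun n : ℕ => (((1 / ((n : ℝ) + 1) : ℝ)) : ℂ)) Filter.atTop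
      (nhdsWithin 0 {0}ᶜ) := by
    refine tendsto_nhdsWithin_iff.2 ⟨?_, ?_⟩
    · have := (Complex.continuous_ofReal.tendsto 0).comp
        (tendsto_one_div_add_atTop_nhds_zero_nat (𝕜 := ℝ))
      simpa [Function.comp_def] using this
    · refine Filter.Eventually.of_forall fun n => ?_
      simp only [mem_compl_iff, mem_singleton_iff, Complex.ofReal_eq_zero]
      positivity
  exact ht.frequently (Filter.Frequently.of_forall fun n => h0 _)

/-- The factorization identity
`A·Δh − h·ΔA = ∇⁻(A·A⁺·∇(h/A))` for `A, h ∈ C^±_r` with `A` invertible in the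
Banach algebra `C^±_r`; here `Δ = ∇ − ∇⁻`, `∇φ = φ⁺ − φ`, `∇⁻φ = φ − φ⁻`,
`w = h/A`, and `Ap, Am, hp, hm, wp, wm, Pm` denote the corresponding `⁺`/`⁻`
functions. -/
theorem factorization_identity (τ M ρ r : ℝ) (hτ : 0 < τ)
    (hM : 2 * zetaR (1 + τ) < M) (hρ : 0 < ρ) (hr : 0 < r)
    (A Ap Am hh hp hm w wp wm Pm : OnePoint ℂ → ℂ × ℂ → ℂ)
    -- `A ∈ C^±_r` :
    (hA : InC τ M r ρ A) (hAp : InC τ M r ρ Ap) (hAm : InC τ M r ρ Am)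
    (hA1 : IsPlus τ M r ρ A Ap) (hA2 : IsMinus τ M r ρ A Am)
    -- `h ∈ C^±_r` :
    (hh1 : InC τ M r ρ hh) (hhp : InC τ M r ρ hp) (hhm : InC τ M r ρ hm)
    (hh2 : IsPlus τ M r ρ hh hp) (hh3 : IsMinus τ M r ρ hh hm)
    -- `A` is invertible in the Banach algebra `C^±_r` :
    (hinv : ∃ Ai Aip Aim : OnePoint ℂ → ℂ × ℂ → ℂ,
      InC τ M r ρ Ai ∧ InC τ M r ρ Aip ∧ InC τ M r ρ Aim ∧
      IsPlus τ M r ρ Ai Aip ∧ IsMinus τ M r ρ Ai Aim ∧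
      ∀ q ∈ KM τ M, ∀ pt ∈ SD r ρ, A q pt * Ai q pt = 1)
    -- `w = h/A ∈ C^±_r` :
    (hw0 : ∀ q ∈ KM τ M, ∀ pt ∈ SD r ρ, A q pt * w q pt = hh q pt)
    (hw : InC τ M r ρ w) (hwp : InC τ M r ρ wp) (hwm : InC τ M r ρ wm)
    (hw1 : IsPlus τ M r ρ w wp) (hw2 : IsMinus τ M r ρ w wm)
    -- `Pm = (A·A⁺·∇(h/A))⁻` :
    (hP : InC τ M r ρ (fun q pt => A q pt * Ap q pt * (wp q pt - w q pt)))
    (hPm : InC τ M r ρ Pm)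
    (hP1 : IsMinus τ M r ρ (fun q pt => A q pt * Ap q pt * (wp q pt - w q pt)) Pm) :
    ∀ q ∈ KM τ M, ∀ pt ∈ SD r ρ,
      A q pt * (hp q pt - 2 * hh q pt + hm q pt) -
          hh q pt * (Ap q pt - 2 * A q pt + Am q pt) =
        A q pt * Ap q pt * (wp q pt - w q pt) - Pm q pt := by
  have hne := AMR_nonempty hτ hM
  have hreal : ∀ q : ℂ, (q : OnePoint ℂ) ∈ KM τ M → q ≠ 0 → ∀ ε ∈ ball (0 : ℂ) ρ, ∀ t : ℝ,
      A q (t, ε) * (hp q (t, ε) - 2 * hh q (t, ε) + hm q (t, ε)) -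
          hh q (t, ε) * (Ap q (t, ε) - 2 * A q (t, ε) + Am q (t, ε)) =
        A q (t, ε) * Ap q (t, ε) * (wp q (t, ε) - w q (t, ε)) - Pm q (t, ε) := by
    intro q hq hq0 ε hε t
    have hSD : ∀ t : ℝ, ((t : ℂ), ε) ∈ SD r ρ := fun t => ⟨ofReal_mem_Strip hr t, hε⟩
    have tAp := hA.isTwist_plus hA1 hA2 hr hq0 hq hε
    have tAm := hA.isTwist_minus hA1 hA2 hr hq0 hq hε
    have thp := hh1.isTwist_plus hh2 hh3 hr hq0 hq hε
    have thm := hh1.isTwist_minus hh2 hh3 hr hq0 hq hε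
    have twp := hw.isTwist_plus hw1 hw2 hr hq0 hq hε
    have eAw : (fun t : ℝ => A q (t, ε) * w q (t, ε)) = fun t : ℝ => hh q (t, ε) :=
      funext fun t => hw0 q hq _ (hSD t)
    have tAw := tAp.mul hq0 twp
    rw [eAw] at tAw
    have ehp := tAw.unique thp
    have eP : (fun t : ℝ => A q (t, ε) * Ap q (t, ε) * (wp q (t, ε) - w q (t, ε))) =
        fun t : ℝ => A q (t, ε) * hp q (t, ε) - hh q (t, ε) * Ap q (t, ε) := by
      funext t
      have h1 := congrFun ehp t
      have h2 := congrFun eAw t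
      beta_reduce at h1 h2 ⊢
      rw [← h1, ← h2]
      ring
    have hqi : q⁻¹ ≠ 0 := inv_ne_zero hq0
    have tP := (tAm.mul hqi (thp.symm hq0)).sub (thm.mul hqi (tAp.symm hq0))
    rw [← eP] at tP
    have h1 := tP.hasSum t
    have h2 := hP1 q hq hq0 t (ofReal_mem_Strip hr t) ε hε
    simp only [inv_zpow'] at h1
    have ePm := h1.unique h2
    have h3 := congrFun eP t
    beta_reduce at h3
    rw [h3, ← ePm]
    ring
  have hfin : ∀ q : ℂ, (q : OnePoint ℂ) ∈ KM τ M → q ≠ 0 → ∀ pt ∈ SD r ρ,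
      A q pt * (hp q pt - 2 * hh q pt + hm q pt) -
          hh q pt * (Ap q pt - 2 * A q pt + Am q pt) =
        A q pt * Ap q pt * (wp q pt - w q pt) - Pm q pt := by
    rintro q hq hq0 ⟨θ, ε⟩ ⟨hθ, hε⟩
    have d {u} (hu : InC τ M r ρ u) := hu.differentiableOn hq hε
    have hd := (((d hA).mul (((d hhp).sub ((d hh1).const_mul 2)).add (d hhm))).sub
      ((d hh1).mul (((d hAp).sub ((d hA).const_mul 2)).add (d hAm)))).sub
      ((((d hA).mul (d hAp)).mul ((d hwp).sub (d hw))).sub (d hPm))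
    exact sub_eq_zero.1 (eqOn_zero_Strip hr hd (fun t => sub_eq_zero.2 (hreal q hq hq0 ε hε t)) hθ)
  intro q hq pt hpt
  induction q using OnePoint.rec with
  | coe q =>
    have c {u} (hu : InC τ M r ρ u) := hu.continuousOn_finPart hpt
    have hE := EqOn.of_subset_closure (s := finPart (KM τ M) \ {0})
      (fun q hq => hfin q hq.1 hq.2 pt hpt)
      (((c hA).mul (((c hhp).sub ((c hh1).const_mul 2)).add (c hhm))).sub
        ((c hh1).mul (((c hAp).sub ((c hA).const_mul 2)).add (c hAm))))
      ((((c hA).mul (c hAp)).mul ((c hwp).sub (c hw))).sub (c hPm))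
      sdiff_subset (finPart_KM_subset_closure hne)
    exact hE hq
  | infty =>
    have c {u} (hu : InC τ M r ρ u) := hu.continuousOn_infPart hpt
    have hE := EqOn.of_subset_closure (s := infPart (KM τ M) \ {0})
      (fun ξ hξ => by
        have hξ0 : ξ ≠ 0 := hξ.2
        have hK : sphChart ξ ∈ KM τ M := hξ.1
        rw [sphChart_of_ne_zero hξ0] at hK
        have := hfin ξ⁻¹ hK (inv_ne_zero hξ0) pt hpt
        rwa [← sphChart_of_ne_zero hξ0] at this)
      (((c hA).mul (((c hhp).sub ((c hh1).const_mul 2)).add (c hhm))).sub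
        ((c hh1).mul (((c hAp).sub ((c hA).const_mul 2)).add (c hAm))))
      ((((c hA).mul (c hAp)).mul ((c hwp).sub (c hw))).sub (c hPm))
      sdiff_subset (infPart_KM_subset_closure hne)
    have h0 : sphChart 0 = ∞ := if_pos rfl
    have := hE (show (0 : ℂ) ∈ infPart (KM τ M) by simpa [infPart, h0] using hq)
    simpa only [Pi.sub_apply, Pi.add_apply, Pi.mul_apply, h0] using this
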